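/- For every integer g with g > 106, the images of a₁a₂′⁵, a₂′⁶, and c₂³ in S(g) form a ℚ-basis of the weighted-degree-6 component S(g)_6; in particular dim_ℚ S(g)_6 = 3. -/

import Mathlib

open MvPolynomial

noncomputable section

/-- The polynomial ring `ℚ[a₁, a₂′, a₂, c₂]`. -/
abbrev P4 : Type := MvPolynomial (Fin 4) ℚ

/-- Weights: `a₁` and `a₂′` have weight 1; `a₂` and `c₂` have weight 2. -/
def wt : Fin 4 → ℕ := ![1, 1, 2, 2]

def a1 : P4 := X 0
def a2' : P4 := X 1
def a2 : P4 := X 2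
def c2 : P4 := X 3

/-- The relation `r₁`. -/
def r1 (g : ℤ) : P4 :=
  C (1064*(g:ℚ) + 3610) * a1^3 - C (1074 : ℚ) * (a1^2 * a2')
    - C (2148*(g:ℚ) + 7272) * (a1 * a2) + C (2160 : ℚ) * (a2 * a2')
    - C (1064*(g:ℚ)^3 + 10830*(g:ℚ)^2 + 36680*(g:ℚ) + 41360) * (a1 * c2)
    + C (1074*(g:ℚ)^2 + 7272*(g:ℚ) + 12288) * (a2' * c2)

/-- The relation `r₂`. -/
def r2 (g : ℤ) : P4 :=
  - C (6412*(g:ℚ) + 21255) * a1^3 + C (6207 : ℚ) * (a1^2 * a2')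
    + C (12414*(g:ℚ) + 40896) * (a1 * a2) - C (11880 : ℚ) * (a2 * a2')
    + C (6412*(g:ℚ)^3 + 63765*(g:ℚ)^2 + 211540*(g:ℚ) + 234480) * (a1 * c2)
    - C (6207*(g:ℚ)^2 + 40896*(g:ℚ) + 68184) * (a2' * c2)

/-- The relation `r₃`. -/
def r3 (g : ℤ) : P4 :=
  - C (22845*(g:ℚ) + 67763) * a1^4 + C (18141 : ℚ) * (a1^3 * a2')
    + C (54423*(g:ℚ) + 146550) * (a1^2 * a2) - C (35640 : ℚ) * (a1 * a2 * a2')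
    + C (45690*(g:ℚ)^3 + 406578*(g:ℚ)^2 + 1184220*(g:ℚ) + 1123060) * (a1^2 * c2)
    - C (54423*(g:ℚ)^2 + 293100*(g:ℚ) + 372648) * (a1 * a2' * c2)
    + C (17820*(g:ℚ) + 24840) * (a2'^2 * c2)
    - C (17820*(g:ℚ) + 24840) * (a2^2)
    - C (18141*(g:ℚ)^3 + 146550*(g:ℚ)^2 + 372648*(g:ℚ) + 283824) * (a2 * c2)
    - C (4569*(g:ℚ)^5 + 67763*(g:ℚ)^4 + 394740*(g:ℚ)^3 + 1123060*(g:ℚ)^2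
        + 1546176*(g:ℚ) + 810432) * (c2^2)

/-- The relation `r₄`. -/
def r4 (g : ℤ) : P4 :=
  C (133 : ℚ) * a1^4 - C (537 : ℚ) * (a1^2 * a2)
    - C (798*(g:ℚ)^2 + 5415*(g:ℚ) + 9170) * (a1^2 * c2)
    + C (1074*(g:ℚ) + 3636) * (a1 * a2' * c2)
    - C (540 : ℚ) * (a2'^2 * c2) + C (540 : ℚ) * (a2^2)
    + C (537*(g:ℚ)^2 + 3636*(g:ℚ) + 6144) * (a2 * c2)
    + C (133*(g:ℚ)^4 + 1805*(g:ℚ)^3 + 9170*(g:ℚ)^2 + 20680*(g:ℚ) + 17472) * (c2^2)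

/-- The relation `r₅`. -/
def r5 (g : ℤ) : P4 :=
  - C (18545*(g:ℚ) + 68407) * a1^4 + C (15261 : ℚ) * (a1^3 * a2')
    + C (45783*(g:ℚ) + 175866) * (a1^2 * a2) - C (31320 : ℚ) * (a1 * a2 * a2')
    + C (37090*(g:ℚ)^3 + 410442*(g:ℚ)^2 + 1499460*(g:ℚ) + 1811300) * (a1^2 * c2)
    - C (45783*(g:ℚ)^2 + 351732*(g:ℚ) + 662976) * (a1 * a2' * c2)
    + C (15660*(g:ℚ) + 72360) * (a2'^2 * c2)
    - C (15660*(g:ℚ) + 72360) * (a2^2)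
    - C (15261*(g:ℚ)^3 + 175866*(g:ℚ)^2 + 662976*(g:ℚ) + 822096) * (a2 * c2)
    - C (3709*(g:ℚ)^5 + 68407*(g:ℚ)^4 + 499820*(g:ℚ)^3 + 1811300*(g:ℚ)^2
        + 3260256*(g:ℚ) + 2334528) * (c2^2)

/-- The ideal `J(g) = (r₁, r₂, r₃, r₄, r₅)`. -/
def Jg (g : ℤ) : Ideal P4 := Ideal.span {r1 g, r2 g, r3 g, r4 g, r5 g}

/-- The quotient map `P → S(g) = P/J(g)`, as a `ℚ`-linear map. -/
def Smk (g : ℤ) : P4 →ₗ[ℚ] P4 ⧸ Jg g := (Ideal.Quotient.mkₐ ℚ (Jg g)).toLinearMap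

/-- `S(g)_i`: the image in `S(g)` of the weighted-degree-`i` homogeneous polynomials. -/
def SComp (g : ℤ) (i : ℕ) : Submodule ℚ (P4 ⧸ Jg g) :=
  (weightedHomogeneousSubmodule ℚ wt i).map (Smk g)

/-- The monomial `a₁ⁱ a₂′ʲ a₂ᵏ c₂ˡ`. -/
def mon (i j k l : ℕ) : P4 := a1 ^ i * a2' ^ j * a2 ^ k * c2 ^ l

/-- The recurrences satisfied by the values `T i j k l` on the monomials `a₁ⁱ a₂′ʲ a₂ᵏ c₂ˡ` of a
linear functional that vanishes on `J(q)`. -/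
structure IsRec (q : ℚ) (T : ℕ → ℕ → ℕ → ℕ → ℚ) : Prop where
  cubic₁ : ∀ i j k l,
      -(28 * q + 70) * T (i + 3) j k l
      + 15 * T (i + 2) (j + 1) k l
      + (30 * q + 45) * T (i + 1) j (k + 1) l
      + (28 * q ^ 3 + 210 * q ^ 2 + 490 * q + 350) * T (i + 1) j k (l + 1)
      - (15 * q ^ 2 + 45 * q + 30) * T i (j + 1) k (l + 1) = 0
  cubic₂ : ∀ i j k l,
      -(2352 * q + 3505) * T (i + 3) j k l
      - 10125 * T (i + 1) j (k + 1) l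
      + 5400 * T i (j + 1) (k + 1) l
      + (2352 * q ^ 3 + 10515 * q ^ 2 - 3990 * q - 40750) * T (i + 1) j k (l + 1)
      + (10125 * q + 25350) * T i (j + 1) k (l + 1) = 0
  quartic₁ : ∀ i j k l,
      -(29 * q + 30) * T (i + 4) j k l
      + (105 * q + 150) * T (i + 2) j (k + 1) l
      + (254 * q ^ 3 + 1650 * q ^ 2 + 3395 * q + 2250) * T (i + 2) j k (l + 1)
      - (210 * q ^ 2 + 615 * q + 450) * T (i + 1) (j + 1) k (l + 1)
      - (105 * q ^ 3 + 465 * q ^ 2 + 660 * q + 300) * T i j (k + 1) (l + 1)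
      - (45 * q ^ 5 + 520 * q ^ 4 + 2275 * q ^ 3 + 4700 * q ^ 2 + 4580 * q + 1680) * T i j k (l +
        2) = 0
  quartic₂ : ∀ i j k l,
      (197 * q + 380) * T (i + 4) j k l
      - (390 * q + 750) * T (i + 2) j (k + 1) l
      - (1122 * q ^ 3 + 7740 * q ^ 2 + 17185 * q + 12400) * T (i + 2) j k (l + 1)
      + (780 * q ^ 2 + 2670 * q + 2250) * T (i + 1) (j + 1) k (l + 1)
      + (390 * q ^ 3 + 1920 * q ^ 2 + 3030 * q + 1500) * T i j (k + 1) (l + 1)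
      + (185 * q ^ 5 + 2200 * q ^ 4 + 9975 * q ^ 3 + 21500 * q ^ 2 + 21940 * q + 8400) * T i j k
        (l + 2) = 0
  quartic₃ : ∀ i j k l,
      133 * T (i + 4) j k l
      - 537 * T (i + 2) j (k + 1) l
      - (798 * q ^ 2 + 5415 * q + 9170) * T (i + 2) j k (l + 1)
      + (1074 * q + 3636) * T (i + 1) (j + 1) k (l + 1)
      - 540 * T i (j + 2) k (l + 1)
      + 540 * T i j (k + 2) l
      + (537 * q ^ 2 + 3636 * q + 6144) * T i j (k + 1) (l + 1)
      + (133 * q ^ 4 + 1805 * q ^ 3 + 9170 * q ^ 2 + 20680 * q + 17472) * T i j k (l + 2) = 0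

/-- The coefficient of `c₂³` in the monomial `a₁ⁱ a₂′ʲ a₂ᵏ c₂ˡ` of weight six modulo `J(q)`. -/
def c2CubeCoeff (q : ℚ) : ℕ → ℕ → ℕ → ℕ → ℚ
  | 6, 0, 0, 0 => (q ^ 6 + 12 * q ^ 5 + 52 * q ^ 4 + 96 * q ^ 3 + 68 * q ^ 2 + 16 * q) / 7
  | 5, 1, 0, 0 => (2 * q ^ 7 + 31 * q ^ 6 + 188 * q ^ 5 + 556 * q ^ 4 + 808 * q ^ 3 + 508 * q ^ 2
    + 112 * q) / 15
  | 4, 2, 0, 0 => (5880 * q ^ 8 + 111714 * q ^ 7 + 871625 * q ^ 6 + 3568688 * q ^ 5 + 8095464 * q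
    ^ 4 + 9806018 * q ^ 3 + 5555386 * q ^ 2 + 1152200 * q) / 47250
  | 3, 3, 0, 0 => (987840 * q ^ 9 + 22223376 * q ^ 8 + 212085210 * q ^ 7 + 1111796455 * q ^ 6 +
    3457435596 * q ^ 5 + 6405406732 * q ^ 4 + 6696691964 * q ^ 3 + 3458614357 * q ^ 2 + 677164180
    * q) / 8505000
  | 2, 4, 0, 0 => (331914240 * q ^ 10 + 8627738112 * q ^ 9 + 97373809152 * q ^ 8 + 622782599232 *
    q ^ 7 + 2468215161762 * q ^ 6 + 6215335249417 * q ^ 5 + 9777790002605 * q ^ 4 + 9032135437579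
    * q ^ 3 + 4292006147281 * q ^ 2 + 795763862740 * q) / 3061800000
  | 4, 0, 0, 1 => (3 * q ^ 4 + 24 * q ^ 3 + 52 * q ^ 2 + 16 * q) / 35
  | 3, 1, 0, 1 => (6 * q ^ 5 + 69 * q ^ 4 + 272 * q ^ 3 + 396 * q ^ 2 + 112 * q) / 75
  | 2, 2, 0, 1 => (3528 * q ^ 6 + 52918 * q ^ 5 + 301919 * q ^ 4 + 792562 * q ^ 3 + 880738 * q ^ 2
    + 230440 * q) / 47250
  | 1, 3, 0, 1 => (592704 * q ^ 7 + 10964016 * q ^ 6 + 81829446 * q ^ 5 + 310635693 * q ^ 4 +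
    613889020 * q ^ 3 + 556468671 * q ^ 2 + 135433340 * q) / 8505000
  | 0, 4, 0, 1 => (199148544 * q ^ 8 + 4380590592 * q ^ 7 + 40382795520 * q ^ 6 + 200567968704 * q
    ^ 5 + 571447568478 * q ^ 4 + 908669237179 * q ^ 3 + 699671317743 * q ^ 2 + 159155163020 * q) /
    3061800000
  | 2, 0, 0, 2 => (q ^ 2 + 4 * q) / 7
  | 1, 1, 0, 2 => (2 * q ^ 3 + 15 * q ^ 2 + 28 * q) / 15
  | 0, 2, 0, 2 => (1176 * q ^ 4 + 12938 * q ^ 3 + 47349 * q ^ 2 + 57652 * q) / 9450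
  | 0, 0, 0, 3 => 1
  | 4, 0, 1, 0 => (2 * q ^ 6 + 15 * q ^ 5 + 4 * q ^ 4 - 188 * q ^ 3 - 396 * q ^ 2 - 112 * q) / 75
  | 3, 1, 1, 0 => (1176 * q ^ 7 + 12938 * q ^ 6 + 33249 * q ^ 5 - 102178 * q ^ 4 - 619460 * q ^ 3
    - 880570 * q ^ 2 - 230440 * q) / 47250
  | 2, 2, 1, 0 => (197568 * q ^ 8 + 2865072 * q ^ 7 + 13194726 * q ^ 6 + 2401723 * q ^ 5 -
    164067739 * q ^ 4 - 511998275 * q ^ 3 - 556311785 * q ^ 2 - 135432500 * q) / 8505000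
  | 1, 3, 1, 0 => (66382848 * q ^ 9 + 1194891264 * q ^ 8 + 7801343424 * q ^ 7 + 16319071104 * q ^
    6 - 52294939026 * q ^ 5 - 364884065463 * q ^ 4 - 788795666566 * q ^ 3 - 699466436205 * q ^ 2 -
    159152590100 * q) / 3061800000
  | 0, 4, 1, 0 => (22304636928 * q ^ 10 + 479473827840 * q ^ 9 + 4025077926912 * q ^ 8 +
    14647951984896 * q ^ 7 + 1588676519328 * q ^ 6 - 184131082609632 * q ^ 5 - 694044842412138 * q
    ^ 4 - 1162315690192909 * q ^ 3 - 875655446242665 * q ^ 2 - 186983366479700 * q) /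
    1102248000000
  | 2, 0, 1, 1 => (-2 * q ^ 4 - 31 * q ^ 3 - 148 * q ^ 2 - 224 * q) / 75
  | 1, 1, 1, 1 => (-1176 * q ^ 5 - 22338 * q ^ 4 - 150769 * q ^ 3 - 436152 * q ^ 2 - 460880 * q) /
    47250
  | 0, 2, 1, 1 => (-197568 * q ^ 6 - 4444272 * q ^ 5 - 38465286 * q ^ 4 - 161941583 * q ^ 3 -
    333947241 * q ^ 2 - 271077940 * q) / 8505000
  | 0, 0, 1, 2 => (-2 * q ^ 2 - 15 * q - 28) / 5
  | 2, 0, 2, 0 => (1176 * q ^ 6 + 17642 * q ^ 5 + 115561 * q ^ 4 + 424598 * q ^ 3 + 866798 * q ^ 2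
    + 757400 * q) / 47250
  | 1, 1, 2, 0 => (197568 * q ^ 7 + 3654672 * q ^ 6 + 29776314 * q ^ 5 + 139206147 * q ^ 4 +
    395039348 * q ^ 3 + 636540321 * q ^ 2 + 445134340 * q) / 8505000
  | 0, 2, 2, 0 => (66382848 * q ^ 8 + 1460196864 * q ^ 7 + 14300875392 * q ^ 6 + 81777859776 * q ^
    5 + 296399240130 * q ^ 4 + 678384367205 * q ^ 3 + 898127188305 * q ^ 2 + 523524771700 * q) /
    3061800000
  | 0, 0, 2, 1 => (8232 * q ^ 4 + 118766 * q ^ 3 + 648783 * q ^ 2 + 1592164 * q + 1481760) / 47250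
  | 0, 0, 3, 0 => (-592704 * q ^ 6 - 13332816 * q ^ 5 - 122895354 * q ^ 4 - 599133697 * q ^ 3 -
    1641491847 * q ^ 2 - 2412262412 * q - 1493614080) / 8505000
  | _, _, _, _ => 0

theorem mul_apply_eq_apply_C_mul (ψ : P4 →ₗ[ℚ] ℚ) (c : ℚ) (p : P4) : c * ψ p = ψ (C c * p) := by
  rw [← smul_eq_C_mul, map_smul, smul_eq_mul]

theorem apply_mon_mul_r1 (g : ℤ) (ψ : P4 →ₗ[ℚ] ℚ) (i j k l : ℕ) :
    ψ (mon i j k l * r1 g) =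
      (1064 * (g : ℚ) + 3610) * ψ (mon (i + 3) j k l)
      - 1074 * ψ (mon (i + 2) (j + 1) k l)
      - (2148 * (g : ℚ) + 7272) * ψ (mon (i + 1) j (k + 1) l)
      + 2160 * ψ (mon i (j + 1) (k + 1) l)
      - (1064 * (g : ℚ) ^ 3 + 10830 * (g : ℚ) ^ 2 + 36680 * (g : ℚ) + 41360) * ψ (mon (i + 1) j k
        (l + 1))
      + (1074 * (g : ℚ) ^ 2 + 7272 * (g : ℚ) + 12288) * ψ (mon i (j + 1) k (l + 1)) := by
  simp only [mul_apply_eq_apply_C_mul, ← map_add, ← map_sub]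
  congr 1
  simp only [mon, r1, map_add, map_mul, map_pow, map_ofNat]
  ring

theorem apply_mon_mul_r2 (g : ℤ) (ψ : P4 →ₗ[ℚ] ℚ) (i j k l : ℕ) :
    ψ (mon i j k l * r2 g) =
      -(6412 * (g : ℚ) + 21255) * ψ (mon (i + 3) j k l)
      + 6207 * ψ (mon (i + 2) (j + 1) k l)
      + (12414 * (g : ℚ) + 40896) * ψ (mon (i + 1) j (k + 1) l)
      - 11880 * ψ (mon i (j + 1) (k + 1) l)
      + (6412 * (g : ℚ) ^ 3 + 63765 * (g : ℚ) ^ 2 + 211540 * (g : ℚ) + 234480) * ψ (mon (i + 1) j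
        k (l + 1))
      - (6207 * (g : ℚ) ^ 2 + 40896 * (g : ℚ) + 68184) * ψ (mon i (j + 1) k (l + 1)) := by
  simp only [mul_apply_eq_apply_C_mul, ← map_add, ← map_sub]
  congr 1
  simp only [mon, r2, map_add, map_mul, map_neg, map_pow, map_ofNat]
  ring

theorem apply_mon_mul_r3 (g : ℤ) (ψ : P4 →ₗ[ℚ] ℚ) (i j k l : ℕ) :
    ψ (mon i j k l * r3 g) =
      -(22845 * (g : ℚ) + 67763) * ψ (mon (i + 4) j k l)
      + 18141 * ψ (mon (i + 3) (j + 1) k l)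
      + (54423 * (g : ℚ) + 146550) * ψ (mon (i + 2) j (k + 1) l)
      - 35640 * ψ (mon (i + 1) (j + 1) (k + 1) l)
      + (45690 * (g : ℚ) ^ 3 + 406578 * (g : ℚ) ^ 2 + 1184220 * (g : ℚ) + 1123060) * ψ (mon (i +
        2) j k (l + 1))
      - (54423 * (g : ℚ) ^ 2 + 293100 * (g : ℚ) + 372648) * ψ (mon (i + 1) (j + 1) k (l + 1))
      + (17820 * (g : ℚ) + 24840) * ψ (mon i (j + 2) k (l + 1))
      - (17820 * (g : ℚ) + 24840) * ψ (mon i j (k + 2) l)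
      - (18141 * (g : ℚ) ^ 3 + 146550 * (g : ℚ) ^ 2 + 372648 * (g : ℚ) + 283824) * ψ (mon i j (k +
        1) (l + 1))
      - (4569 * (g : ℚ) ^ 5 + 67763 * (g : ℚ) ^ 4 + 394740 * (g : ℚ) ^ 3 + 1123060 * (g : ℚ) ^ 2 +
        1546176 * (g : ℚ) + 810432) * ψ (mon i j k (l + 2)) := by
  simp only [mul_apply_eq_apply_C_mul, ← map_add, ← map_sub]
  congr 1
  simp only [mon, r3, map_add, map_mul, map_neg, map_pow, map_ofNat]
  ring

theorem apply_mon_mul_r4 (g : ℤ) (ψ : P4 →ₗ[ℚ] ℚ) (i j k l : ℕ) :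
    ψ (mon i j k l * r4 g) =
      133 * ψ (mon (i + 4) j k l)
      - 537 * ψ (mon (i + 2) j (k + 1) l)
      - (798 * (g : ℚ) ^ 2 + 5415 * (g : ℚ) + 9170) * ψ (mon (i + 2) j k (l + 1))
      + (1074 * (g : ℚ) + 3636) * ψ (mon (i + 1) (j + 1) k (l + 1))
      - 540 * ψ (mon i (j + 2) k (l + 1))
      + 540 * ψ (mon i j (k + 2) l)
      + (537 * (g : ℚ) ^ 2 + 3636 * (g : ℚ) + 6144) * ψ (mon i j (k + 1) (l + 1))
      + (133 * (g : ℚ) ^ 4 + 1805 * (g : ℚ) ^ 3 + 9170 * (g : ℚ) ^ 2 + 20680 * (g : ℚ) + 17472) *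
        ψ (mon i j k (l + 2)) := by
  simp only [mul_apply_eq_apply_C_mul, ← map_add, ← map_sub]
  congr 1
  simp only [mon, r4, map_add, map_mul, map_pow, map_ofNat]
  ring

theorem apply_mon_mul_r5 (g : ℤ) (ψ : P4 →ₗ[ℚ] ℚ) (i j k l : ℕ) :
    ψ (mon i j k l * r5 g) =
      -(18545 * (g : ℚ) + 68407) * ψ (mon (i + 4) j k l)
      + 15261 * ψ (mon (i + 3) (j + 1) k l)
      + (45783 * (g : ℚ) + 175866) * ψ (mon (i + 2) j (k + 1) l)
      - 31320 * ψ (mon (i + 1) (j + 1) (k + 1) l)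
      + (37090 * (g : ℚ) ^ 3 + 410442 * (g : ℚ) ^ 2 + 1499460 * (g : ℚ) + 1811300) * ψ (mon (i +
        2) j k (l + 1))
      - (45783 * (g : ℚ) ^ 2 + 351732 * (g : ℚ) + 662976) * ψ (mon (i + 1) (j + 1) k (l + 1))
      + (15660 * (g : ℚ) + 72360) * ψ (mon i (j + 2) k (l + 1))
      - (15660 * (g : ℚ) + 72360) * ψ (mon i j (k + 2) l)
      - (15261 * (g : ℚ) ^ 3 + 175866 * (g : ℚ) ^ 2 + 662976 * (g : ℚ) + 822096) * ψ (mon i j (k +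
        1) (l + 1))
      - (3709 * (g : ℚ) ^ 5 + 68407 * (g : ℚ) ^ 4 + 499820 * (g : ℚ) ^ 3 + 1811300 * (g : ℚ) ^ 2 +
        3260256 * (g : ℚ) + 2334528) * ψ (mon i j k (l + 2)) := by
  simp only [mul_apply_eq_apply_C_mul, ← map_add, ← map_sub]
  congr 1
  simp only [mon, r5, map_add, map_mul, map_neg, map_pow, map_ofNat]
  ring

theorem isRec_of_vanishing (g : ℤ) (ψ : P4 →ₗ[ℚ] ℚ) (hψ : ∀ p ∈ Jg g, ψ p = 0) :
    IsRec g fun i j k l => ψ (mon i j k l) := by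
  have h₁ (i j k l : ℕ) := (apply_mon_mul_r1 g ψ i j k l).symm.trans
    (hψ _ (Ideal.mul_mem_left _ _ (Ideal.subset_span (by simp))))
  have h₂ (i j k l : ℕ) := (apply_mon_mul_r2 g ψ i j k l).symm.trans
    (hψ _ (Ideal.mul_mem_left _ _ (Ideal.subset_span (by simp))))
  have h₃ (i j k l : ℕ) := (apply_mon_mul_r3 g ψ i j k l).symm.trans
    (hψ _ (Ideal.mul_mem_left _ _ (Ideal.subset_span (by simp))))
  have h₄ (i j k l : ℕ) := (apply_mon_mul_r4 g ψ i j k l).symm.trans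
    (hψ _ (Ideal.mul_mem_left _ _ (Ideal.subset_span (by simp))))
  have h₅ (i j k l : ℕ) := (apply_mon_mul_r5 g ψ i j k l).symm.trans
    (hψ _ (Ideal.mul_mem_left _ _ (Ideal.subset_span (by simp))))
  refine ⟨fun i j k l => ?_, fun i j k l => ?_, fun i j k l => ?_, fun i j k l => ?_,
    fun i j k l => ?_⟩
  · linear_combination 11 / 40 * h₁ i j k l + 1 / 20 * h₂ i j k l
  · linear_combination (5 / 2 + 179 * 11 / 40) * h₁ i j k l + 179 / 20 * h₂ i j k l
  · linear_combination 1 / 4 * h₃ i j k l + (33 / 4 * g + 23 / 2) * h₄ i j k l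
      + (-6047 / 20 * (11 / 40) + 33 / 20 * (5 / 2 + 179 * 11 / 40)) * h₁ (i + 1) j k l
      + (-6047 / 20 * (1 / 20) + 33 / 20 * (179 / 20)) * h₂ (i + 1) j k l
  · linear_combination 5 / 4 * h₅ i j k l + (145 / 4 * g + 335 / 2) * h₄ i j k l
      + (-5087 / 4 * (11 / 40) + 29 / 4 * (5 / 2 + 179 * 11 / 40)) * h₁ (i + 1) j k l
      + (-5087 / 4 * (1 / 20) + 29 / 4 * (179 / 20)) * h₂ (i + 1) j k l
  · linear_combination h₄ i j k l

theorem monomial_eq_C_mul_mon (m : Fin 4 →₀ ℕ) (c : ℚ) :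
    monomial m c = C c * mon (m 0) (m 1) (m 2) (m 3) := by
  rw [monomial_eq, Finsupp.prod_fintype _ _ (by simp)]
  simp [Fin.prod_univ_four, mon, a1, a2', a2, c2]

theorem apply_mul_eq_zero (ψ : P4 →ₗ[ℚ] ℚ) {r : P4} (h : ∀ i j k l, ψ (mon i j k l * r) = 0)
    (p : P4) : ψ (p * r) = 0 := by
  induction p using MvPolynomial.induction_on' with
  | monomial m c =>
    rw [monomial_eq_C_mul_mon, mul_assoc, ← mul_apply_eq_apply_C_mul, h, mul_zero]
  | add p q hp hq => rw [add_mul, map_add, hp, hq, add_zero]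

theorem vanishing_of_isRec (g : ℤ) (ψ : P4 →ₗ[ℚ] ℚ)
    (hT : IsRec g fun i j k l => ψ (mon i j k l)) {p : P4} (hp : p ∈ Jg g) : ψ p = 0 := by
  suffices ∀ q, ψ (q * p) = 0 by simpa using this 1
  induction hp using Submodule.span_induction with
  | mem r hr =>
    refine apply_mul_eq_zero ψ fun i j k l => ?_
    simp only [Set.mem_insert_iff, Set.mem_singleton_iff] at hr
    rcases hr with rfl | rfl | rfl | rfl | rfl
    · rw [apply_mon_mul_r1]
      linear_combination 2 / 5 * hT.cubic₂ i j k l - 358 / 5 * hT.cubic₁ i j k l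
    · rw [apply_mon_mul_r2]
      linear_combination 2069 / 5 * hT.cubic₁ i j k l - 11 / 5 * hT.cubic₂ i j k l
    · rw [apply_mon_mul_r3]
      linear_combination 4 * hT.quartic₁ i j k l - (33 * g + 46) * hT.quartic₃ i j k l
        + 6047 / 5 * hT.cubic₁ (i + 1) j k l - 33 / 5 * hT.cubic₂ (i + 1) j k l
    · rw [apply_mon_mul_r4]
      linear_combination hT.quartic₃ i j k l
    · rw [apply_mon_mul_r5]
      linear_combination 4 / 5 * hT.quartic₂ i j k l - (29 * g + 134) * hT.quartic₃ i j k l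
        + 5087 / 5 * hT.cubic₁ (i + 1) j k l - 29 / 5 * hT.cubic₂ (i + 1) j k l
  | zero => simp
  | add x y _ _ hx hy => intro q; rw [mul_add, map_add, hx, hy, add_zero]
  | smul a x _ hx => intro q; rw [smul_eq_mul, ← mul_assoc, hx]

theorem exponents_of_weight_three {i j k l : ℕ} (h : i + j + 2 * k + 2 * l = 3) :
    (i, j, k, l) ∈ ([(3, 0, 0, 0), (2, 1, 0, 0), (1, 2, 0, 0), (0, 3, 0, 0), (1, 0, 1, 0),
      (0, 1, 1, 0), (1, 0, 0, 1), (0, 1, 0, 1)] : List (ℕ × ℕ × ℕ × ℕ)) := by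
  simp only [List.mem_cons, Prod.mk.injEq, List.not_mem_nil, or_false]
  omega

theorem exponents_of_weight_two {i j k l : ℕ} (h : i + j + 2 * k + 2 * l = 2) :
    (i, j, k, l) ∈ ([(2, 0, 0, 0), (1, 1, 0, 0), (0, 2, 0, 0), (0, 0, 1, 0), (0, 0, 0, 1)] :
      List (ℕ × ℕ × ℕ × ℕ)) := by
  simp only [List.mem_cons, Prod.mk.injEq, List.not_mem_nil, or_false]
  omega

theorem c2CubeCoeff_eq_zero (q : ℚ) {i j k l : ℕ} (h : i + j + 2 * k + 2 * l ≠ 6) :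
    c2CubeCoeff q i j k l = 0 := by
  unfold c2CubeCoeff
  split <;> first | rfl | exact absurd rfl h

set_option maxHeartbeats 4000000 in
theorem isRec_c2CubeCoeff (q : ℚ) : IsRec q (c2CubeCoeff q) := by
  have hzero {i j k l : ℕ} := c2CubeCoeff_eq_zero q (i := i) (j := j) (k := k) (l := l)
  refine ⟨fun i j k l => ?_, fun i j k l => ?_, fun i j k l => ?_, fun i j k l => ?_,
    fun i j k l => ?_⟩
  iterate 2
    by_cases h : i + j + 2 * k + 2 * l = 3
    · have := exponents_of_weight_three h
      simp only [List.mem_cons, Prod.mk.injEq, List.not_mem_nil, or_false] at this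
      rcases this with h | h | h | h | h | h | h | h <;> obtain ⟨rfl, rfl, rfl, rfl⟩ := h <;>
        simp only [Nat.reduceAdd, c2CubeCoeff.eq_def] <;> ring
    · repeat rw [hzero (by omega)]
      ring
  iterate 3
    by_cases h : i + j + 2 * k + 2 * l = 2
    · have := exponents_of_weight_two h
      simp only [List.mem_cons, Prod.mk.injEq, List.not_mem_nil, or_false] at this
      rcases this with h | h | h | h | h <;> obtain ⟨rfl, rfl, rfl, rfl⟩ := h <;>
        simp only [Nat.reduceAdd, c2CubeCoeff.eq_def] <;> ring
    · repeat rw [hzero (by omega)]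
      ring

theorem isRec_pi_single (q : ℚ) {e : ℕ} (he : e < 2) (n : ℕ) :
    IsRec q fun i j k l => if i = e ∧ j = n ∧ k = 0 ∧ l = 0 then 1 else 0 := by
  refine ⟨fun i j k l => ?_, fun i j k l => ?_, fun i j k l => ?_, fun i j k l => ?_,
    fun i j k l => ?_⟩
  · simp [show ∀ i, i + 2 ≠ e by omega]
  · simp [show ∀ i, i + 3 ≠ e by omega]
  · simp [show ∀ i, i + 2 ≠ e by omega]
  · simp [show ∀ i, i + 2 ≠ e by omega]
  · simp [show ∀ i, i + 2 ≠ e by omega]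

/-- The recurrences determine a functional in weight six, up to its values at `c₂³`, `a₁a₂′⁵` and
`a₂′⁶`. -/
theorem IsRec.eq_zero_of_weight_six {q : ℚ} (hq : 0 < q) {T : ℕ → ℕ → ℕ → ℕ → ℚ} (hT : IsRec q T)
    (h1500 : T 1 5 0 0 = 0) (h0600 : T 0 6 0 0 = 0) (h0003 : T 0 0 0 3 = 0) {i j k l : ℕ}
    (h : i + j + 2 * k + 2 * l = 6) : T i j k l = 0 := by
  have h2002 : T 2 0 0 2 = 0 := by
    have h : (14000 * q ^ 6 + 165760 * q ^ 5 + 800100 * q ^ 4 + 2013200 * q ^ 3 + 2781100 * q ^ 2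
      + 1995840 * q + 579600) * T 2 0 0 2 = 0 := by
      linear_combination (-416 * q ^ 3 - 2464 * q ^ 2 - 4760 * q - 3000) * hT.quartic₁ 0 0 0 1 +
        (2700 * q + 5400) * hT.quartic₁ 1 1 0 0 +
        (-2850 * q ^ 2 - 15008 * q - 18620) * hT.quartic₁ 2 0 0 0 +
        (-6250 * q ^ 3 - 33375 * q ^ 2 - 59000 * q - 34500) * hT.quartic₃ 2 0 0 0 +
        (-112 * q ^ 3 - 608 * q ^ 2 - 1060 * q - 600) * hT.quartic₂ 0 0 0 1 +
        (-3600 * q - 7200) * hT.quartic₂ 1 1 0 0 +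
        (3800 * q ^ 2 + 20094 * q + 24980) * hT.quartic₂ 2 0 0 0 +
        (-52500 * q ^ 4 - 147225 * q ^ 3 + 441850 * q ^ 2 + 1836900 * q + 1568600) * hT.cubic₁ 1 0
          0 1 +
        (112500 * q ^ 2 + 432000 * q + 414000) * hT.cubic₁ 1 0 1 0 +
        (52500 * q ^ 2 + 201600 * q + 193200) * hT.cubic₁ 3 0 0 0 +
        (625 * q ^ 4 + 4275 * q ^ 3 + 10750 * q ^ 2 + 11700 * q + 4600) * hT.cubic₂ 1 0 0 1 +
        (-625 * q ^ 2 - 2400 * q - 2300) * hT.cubic₂ 3 0 0 0 +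
        (2000 * q ^ 8 + 31680 * q ^ 7 + 209020 * q ^ 6 + 744800 * q ^ 5 + 1547700 * q ^ 4 +
          1874320 * q ^ 3 + 1223280 * q ^ 2 + 331200 * q) * h0003
    exact (mul_eq_zero.1 h).resolve_left (by positivity)
  have h4001 : T 4 0 0 1 = 0 := by
    have h : (625 * q ^ 2 + 2400 * q + 2300) * T 4 0 0 1 = 0 := by
      linear_combination (26 * q + 50) * hT.quartic₁ 0 0 0 1 +
        (7 * q + 10) * hT.quartic₂ 0 0 0 1 +
        (1250 * q ^ 4 + 9800 * q ^ 3 + 26925 * q ^ 2 + 30400 * q + 11500) * h2002 +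
        (-125 * q ^ 6 - 1480 * q ^ 5 - 6675 * q ^ 4 - 14300 * q ^ 3 - 14500 * q ^ 2 - 5520 * q) *
          h0003
    exact (mul_eq_zero.1 h).resolve_left (by positivity)
  have h6000 : T 6 0 0 0 = 0 := by
    have h : (625 * q ^ 2 + 2400 * q + 2300) * T 6 0 0 0 = 0 := by
      linear_combination (26 * q + 50) * hT.quartic₁ 2 0 0 0 +
        (7 * q + 10) * hT.quartic₂ 2 0 0 0 +
        (1250 * q ^ 4 + 9800 * q ^ 3 + 26925 * q ^ 2 + 30400 * q + 11500) * h4001 +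
        (-125 * q ^ 6 - 1480 * q ^ 5 - 6675 * q ^ 4 - 14300 * q ^ 3 - 14500 * q ^ 2 - 5520 * q) *
          h2002
    exact (mul_eq_zero.1 h).resolve_left (by positivity)
  have h1102 : T 1 1 0 2 = 0 := by
    have h : (84000 * q ^ 8 + 1156560 * q ^ 7 + 6778680 * q ^ 6 + 22047900 * q ^ 5 + 43411200 * q
      ^ 4 + 52784340 * q ^ 3 + 38491320 * q ^ 2 + 15260400 * q + 2484000) * T 1 1 0 2 = 0 := by
      linear_combination (-125 * q ^ 6 - 1480 * q ^ 5 - 6675 * q ^ 4 - 14300 * q ^ 3 - 14500 * q ^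
        2 - 5520 * q) * hT.quartic₁ 0 0 0 1 +
        (-2730 * q ^ 4 - 17340 * q ^ 3 - 40410 * q ^ 2 - 40800 * q - 15000) * hT.quartic₁ 0 0 1 0
          +
        (-1638 * q ^ 3 - 7674 * q ^ 2 - 11820 * q - 6000) * hT.quartic₁ 1 1 0 0 +
        (-125 * q ^ 4 - 730 * q ^ 3 - 1670 * q ^ 2 - 1880 * q - 920) * hT.quartic₁ 2 0 0 0 +
        (-735 * q ^ 4 - 4305 * q ^ 3 - 9270 * q ^ 2 - 8700 * q - 3000) * hT.quartic₂ 0 0 1 0 +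
        (-441 * q ^ 3 - 1848 * q ^ 2 - 2580 * q - 1200) * hT.quartic₂ 1 1 0 0 +
        (-4375 * q ^ 6 - 45800 * q ^ 5 - 194085 * q ^ 4 - 427060 * q ^ 3 - 515360 * q ^ 2 - 323760
          * q - 82800) * hT.cubic₁ 1 0 0 1 +
        (2625 * q ^ 4 + 17330 * q ^ 3 + 42500 * q ^ 2 + 45880 * q + 18400) * hT.cubic₁ 3 0 0 0 +
        (-167875 * q ^ 7 - 2280140 * q ^ 6 - 12940850 * q ^ 5 - 39786050 * q ^ 4 - 71566450 * q ^
          3 - 75297660 * q ^ 2 - 42867800 * q - 10166000) * h4001 +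
        (148625 * q ^ 9 + 2685470 * q ^ 8 + 21018830 * q ^ 7 + 93439330 * q ^ 6 + 259692205 * q ^
          5 + 467216560 * q ^ 4 + 543011900 * q ^ 3 + 392031800 * q ^ 2 + 158936000 * q +
          27434400) * h2002 +
        (-5625 * q ^ 11 - 131600 * q ^ 10 - 1354350 * q ^ 9 - 8069000 * q ^ 8 - 30802625 * q ^ 7 -
          78681800 * q ^ 6 - 136125800 * q ^ 5 - 157416000 * q ^ 4 - 116378000 * q ^ 3 - 49641600
          * q ^ 2 - 9273600 * q) * h0003 +
        (69875 * q ^ 5 + 644070 * q ^ 4 + 2332770 * q ^ 3 + 4155020 * q ^ 2 + 3643720 * q +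
          1260400) * h6000
    exact (mul_eq_zero.1 h).resolve_left (by positivity)
  have h5100 : T 5 1 0 0 = 0 := by
    have h : (52500 * q ^ 5 + 460350 * q ^ 4 + 1580550 * q ^ 3 + 2651700 * q ^ 2 + 2169000 * q +
      690000) * T 5 1 0 0 = 0 := by
      linear_combination (1092 * q ^ 4 + 6936 * q ^ 3 + 16710 * q ^ 2 + 18150 * q + 7500) *
        hT.quartic₁ 1 1 0 0 +
        (-500 * q ^ 5 - 4670 * q ^ 4 - 16650 * q ^ 3 - 28315 * q ^ 2 - 22840 * q - 6900) *
          hT.quartic₁ 2 0 0 0 +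
        (294 * q ^ 4 + 1722 * q ^ 3 + 3855 * q ^ 2 + 3900 * q + 1500) * hT.quartic₂ 1 1 0 0 +
        (-1750 * q ^ 7 - 21470 * q ^ 6 - 109455 * q ^ 5 - 300735 * q ^ 4 - 480720 * q ^ 3 - 446520
          * q ^ 2 - 222800 * q - 46000) * hT.cubic₁ 1 0 0 1 +
        (1750 * q ^ 5 + 16220 * q ^ 4 + 57295 * q ^ 3 + 96410 * q ^ 2 + 76900 * q + 23000) *
          hT.cubic₁ 3 0 0 0 +
        (-31500 * q ^ 9 - 486210 * q ^ 8 - 3251730 * q ^ 7 - 12363300 * q ^ 6 - 29420700 * q ^ 5 -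
          45357840 * q ^ 4 - 45161220 * q ^ 3 - 27859800 * q ^ 2 - 9582000 * q - 1380000) * h1102
          +
        (34500 * q ^ 6 + 426230 * q ^ 5 + 2116710 * q ^ 4 + 5389495 * q ^ 3 + 7390090 * q ^ 2 +
          5141700 * q + 1403000) * h6000 +
        (29000 * q ^ 8 + 465860 * q ^ 7 + 3196500 * q ^ 6 + 12270000 * q ^ 5 + 28892900 * q ^ 4 +
          42790415 * q ^ 3 + 38886250 * q ^ 2 + 19746500 * q + 4255000) * h4001 +
        (26500 * q ^ 10 + 498510 * q ^ 9 + 4115790 * q ^ 8 + 19632505 * q ^ 7 + 59892610 * q ^ 6 +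
          122035635 * q ^ 5 + 168085550 * q ^ 4 + 154422600 * q ^ 3 + 90507600 * q ^ 2 + 30546800
          * q + 4508000) * h2002
    exact (mul_eq_zero.1 h).resolve_left (by positivity)
  have h3101 : T 3 1 0 1 = 0 := by
    have h : (1250 * q ^ 4 + 9800 * q ^ 3 + 26925 * q ^ 2 + 30400 * q + 11500) * T 3 1 0 1 = 0 :=
      by
      linear_combination (-26 * q - 50) * hT.quartic₁ 1 1 0 0 +
        (-7 * q - 10) * hT.quartic₂ 1 1 0 0 +
        (625 * q ^ 2 + 2400 * q + 2300) * h5100 +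
        (125 * q ^ 6 + 1480 * q ^ 5 + 6675 * q ^ 4 + 14300 * q ^ 3 + 14500 * q ^ 2 + 5520 * q) *
          h1102
    exact (mul_eq_zero.1 h).resolve_left (by positivity)
  have h4010 : T 4 0 1 0 = 0 := by
    have h : (30 * q + 45) * T 4 0 1 0 = 0 := by
      linear_combination hT.cubic₁ 3 0 0 0 +
        (28 * q + 70) * h6000 +
        (-15) * h5100 +
        (-28 * q ^ 3 - 210 * q ^ 2 - 490 * q - 350) * h4001 +
        (15 * q ^ 2 + 45 * q + 30) * h3101
    exact (mul_eq_zero.1 h).resolve_left (by positivity)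
  have h3110 : T 3 1 1 0 = 0 := by
    have h : 5400 * T 3 1 1 0 = 0 := by
      linear_combination hT.cubic₂ 3 0 0 0 +
        (2352 * q + 3505) * h6000 +
        10125 * h4010 +
        (-2352 * q ^ 3 - 10515 * q ^ 2 + 3990 * q + 40750) * h4001 +
        (-10125 * q - 25350) * h3101
    exact (mul_eq_zero.1 h).resolve_left (by positivity)
  have h2011 : T 2 0 1 1 = 0 := by
    have h : (105 * q ^ 3 + 465 * q ^ 2 + 660 * q + 300) * T 2 0 1 1 = 0 := by
      linear_combination (-1) * hT.quartic₁ 2 0 0 0 +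
        (-29 * q - 30) * h6000 +
        (105 * q + 150) * h4010 +
        (254 * q ^ 3 + 1650 * q ^ 2 + 3395 * q + 2250) * h4001 +
        (-210 * q ^ 2 - 615 * q - 450) * h3101 +
        (-45 * q ^ 5 - 520 * q ^ 4 - 2275 * q ^ 3 - 4700 * q ^ 2 - 4580 * q - 1680) * h2002
    exact (mul_eq_zero.1 h).resolve_left (by positivity)
  have h1111 : T 1 1 1 1 = 0 := by
    have h : 5400 * T 1 1 1 1 = 0 := by
      linear_combination hT.cubic₂ 1 0 0 1 +
        (2352 * q + 3505) * h4001 +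
        10125 * h2011 +
        (-2352 * q ^ 3 - 10515 * q ^ 2 + 3990 * q + 40750) * h2002 +
        (-10125 * q - 25350) * h1102
    exact (mul_eq_zero.1 h).resolve_left (by positivity)
  have h2201 : T 2 2 0 1 = 0 := by
    have h : (210 * q ^ 2 + 615 * q + 450) * T 2 2 0 1 = 0 := by
      linear_combination (-1) * hT.quartic₁ 1 1 0 0 +
        (-29 * q - 30) * h5100 +
        (105 * q + 150) * h3110 +
        (254 * q ^ 3 + 1650 * q ^ 2 + 3395 * q + 2250) * h3101 +
        (-105 * q ^ 3 - 465 * q ^ 2 - 660 * q - 300) * h1111 +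
        (-45 * q ^ 5 - 520 * q ^ 4 - 2275 * q ^ 3 - 4700 * q ^ 2 - 4580 * q - 1680) * h1102
    exact (mul_eq_zero.1 h).resolve_left (by positivity)
  have h4200 : T 4 2 0 0 = 0 := by
    have h : 15 * T 4 2 0 0 = 0 := by
      linear_combination hT.cubic₁ 2 1 0 0 +
        (28 * q + 70) * h5100 +
        (-30 * q - 45) * h3110 +
        (-28 * q ^ 3 - 210 * q ^ 2 - 490 * q - 350) * h3101 +
        (15 * q ^ 2 + 45 * q + 30) * h2201
    exact (mul_eq_zero.1 h).resolve_left (by positivity)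
  have h0202 : T 0 2 0 2 = 0 := by
    have h : (15 * q ^ 2 + 45 * q + 30) * T 0 2 0 2 = 0 := by
      linear_combination (-1) * hT.cubic₁ 0 1 0 1 +
        (-28 * q - 70) * h3101 +
        15 * h2201 +
        (30 * q + 45) * h1111 +
        (28 * q ^ 3 + 210 * q ^ 2 + 490 * q + 350) * h1102
    exact (mul_eq_zero.1 h).resolve_left (by positivity)
  have h2210 : T 2 2 1 0 = 0 := by
    have h : 5400 * T 2 2 1 0 = 0 := by
      linear_combination hT.cubic₂ 2 1 0 0 +
        (2352 * q + 3505) * h5100 +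
        10125 * h3110 +
        (-2352 * q ^ 3 - 10515 * q ^ 2 + 3990 * q + 40750) * h3101 +
        (-10125 * q - 25350) * h2201
    exact (mul_eq_zero.1 h).resolve_left (by positivity)
  have h0211 : T 0 2 1 1 = 0 := by
    have h : 5400 * T 0 2 1 1 = 0 := by
      linear_combination hT.cubic₂ 0 1 0 1 +
        (2352 * q + 3505) * h3101 +
        10125 * h1111 +
        (-2352 * q ^ 3 - 10515 * q ^ 2 + 3990 * q + 40750) * h1102 +
        (-10125 * q - 25350) * h0202
    exact (mul_eq_zero.1 h).resolve_left (by positivity)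
  have h1301 : T 1 3 0 1 = 0 := by
    have h : (210 * q ^ 2 + 615 * q + 450) * T 1 3 0 1 = 0 := by
      linear_combination (-1) * hT.quartic₁ 0 2 0 0 +
        (-29 * q - 30) * h4200 +
        (105 * q + 150) * h2210 +
        (254 * q ^ 3 + 1650 * q ^ 2 + 3395 * q + 2250) * h2201 +
        (-105 * q ^ 3 - 465 * q ^ 2 - 660 * q - 300) * h0211 +
        (-45 * q ^ 5 - 520 * q ^ 4 - 2275 * q ^ 3 - 4700 * q ^ 2 - 4580 * q - 1680) * h0202
    exact (mul_eq_zero.1 h).resolve_left (by positivity)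
  have h3300 : T 3 3 0 0 = 0 := by
    have h : 15 * T 3 3 0 0 = 0 := by
      linear_combination hT.cubic₁ 1 2 0 0 +
        (28 * q + 70) * h4200 +
        (-30 * q - 45) * h2210 +
        (-28 * q ^ 3 - 210 * q ^ 2 - 490 * q - 350) * h2201 +
        (15 * q ^ 2 + 45 * q + 30) * h1301
    exact (mul_eq_zero.1 h).resolve_left (by positivity)
  have h1310 : T 1 3 1 0 = 0 := by
    have h : 5400 * T 1 3 1 0 = 0 := by
      linear_combination hT.cubic₂ 1 2 0 0 +
        (2352 * q + 3505) * h4200 +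
        10125 * h2210 +
        (-2352 * q ^ 3 - 10515 * q ^ 2 + 3990 * q + 40750) * h2201 +
        (-10125 * q - 25350) * h1301
    exact (mul_eq_zero.1 h).resolve_left (by positivity)
  have h0012 : T 0 0 1 2 = 0 := by
    have h : (390 * q ^ 3 + 1920 * q ^ 2 + 3030 * q + 1500) * T 0 0 1 2 = 0 := by
      linear_combination hT.quartic₂ 0 0 0 1 +
        (-197 * q - 380) * h4001 +
        (390 * q + 750) * h2011 +
        (1122 * q ^ 3 + 7740 * q ^ 2 + 17185 * q + 12400) * h2002 +
        (-780 * q ^ 2 - 2670 * q - 2250) * h1102 +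
        (-185 * q ^ 5 - 2200 * q ^ 4 - 9975 * q ^ 3 - 21500 * q ^ 2 - 21940 * q - 8400) * h0003
    exact (mul_eq_zero.1 h).resolve_left (by positivity)
  have h2020 : T 2 0 2 0 = 0 := by
    have h : 540 * T 2 0 2 0 = 0 := by
      linear_combination hT.quartic₃ 2 0 0 0 +
        (-133) * h6000 +
        537 * h4010 +
        (798 * q ^ 2 + 5415 * q + 9170) * h4001 +
        (-1074 * q - 3636) * h3101 +
        540 * h2201 +
        (-537 * q ^ 2 - 3636 * q - 6144) * h2011 +
        (-133 * q ^ 4 - 1805 * q ^ 3 - 9170 * q ^ 2 - 20680 * q - 17472) * h2002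
    exact (mul_eq_zero.1 h).resolve_left (by positivity)
  have h1120 : T 1 1 2 0 = 0 := by
    have h : (30 * q + 45) * T 1 1 2 0 = 0 := by
      linear_combination hT.cubic₁ 0 1 1 0 +
        (28 * q + 70) * h3110 +
        (-15) * h2210 +
        (-28 * q ^ 3 - 210 * q ^ 2 - 490 * q - 350) * h1111 +
        (15 * q ^ 2 + 45 * q + 30) * h0211
    exact (mul_eq_zero.1 h).resolve_left (by positivity)
  have h0220 : T 0 2 2 0 = 0 := by
    have h : 5400 * T 0 2 2 0 = 0 := by
      linear_combination hT.cubic₂ 0 1 1 0 +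
        (2352 * q + 3505) * h3110 +
        10125 * h1120 +
        (-2352 * q ^ 3 - 10515 * q ^ 2 + 3990 * q + 40750) * h1111 +
        (-10125 * q - 25350) * h0211
    exact (mul_eq_zero.1 h).resolve_left (by positivity)
  have h0401 : T 0 4 0 1 = 0 := by
    have h : 540 * T 0 4 0 1 = 0 := by
      linear_combination (-1) * hT.quartic₃ 0 2 0 0 +
        133 * h4200 +
        (-537) * h2210 +
        (-798 * q ^ 2 - 5415 * q - 9170) * h2201 +
        (1074 * q + 3636) * h1301 +
        540 * h0220 +
        (537 * q ^ 2 + 3636 * q + 6144) * h0211 +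
        (133 * q ^ 4 + 1805 * q ^ 3 + 9170 * q ^ 2 + 20680 * q + 17472) * h0202
    exact (mul_eq_zero.1 h).resolve_left (by positivity)
  have h2400 : T 2 4 0 0 = 0 := by
    have h : 15 * T 2 4 0 0 = 0 := by
      linear_combination hT.cubic₁ 0 3 0 0 +
        (28 * q + 70) * h3300 +
        (-30 * q - 45) * h1310 +
        (-28 * q ^ 3 - 210 * q ^ 2 - 490 * q - 350) * h1301 +
        (15 * q ^ 2 + 45 * q + 30) * h0401
    exact (mul_eq_zero.1 h).resolve_left (by positivity)
  have h0410 : T 0 4 1 0 = 0 := by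
    have h : 5400 * T 0 4 1 0 = 0 := by
      linear_combination hT.cubic₂ 0 3 0 0 +
        (2352 * q + 3505) * h3300 +
        10125 * h1310 +
        (-2352 * q ^ 3 - 10515 * q ^ 2 + 3990 * q + 40750) * h1301 +
        (-10125 * q - 25350) * h0401
    exact (mul_eq_zero.1 h).resolve_left (by positivity)
  have h0021 : T 0 0 2 1 = 0 := by
    have h : 540 * T 0 0 2 1 = 0 := by
      linear_combination hT.quartic₃ 0 0 0 1 +
        (-133) * h4001 +
        537 * h2011 +
        (798 * q ^ 2 + 5415 * q + 9170) * h2002 +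
        (-1074 * q - 3636) * h1102 +
        540 * h0202 +
        (-537 * q ^ 2 - 3636 * q - 6144) * h0012 +
        (-133 * q ^ 4 - 1805 * q ^ 3 - 9170 * q ^ 2 - 20680 * q - 17472) * h0003
    exact (mul_eq_zero.1 h).resolve_left (by positivity)
  have h0030 : T 0 0 3 0 = 0 := by
    have h : 540 * T 0 0 3 0 = 0 := by
      linear_combination hT.quartic₃ 0 0 1 0 +
        (-133) * h4010 +
        537 * h2020 +
        (798 * q ^ 2 + 5415 * q + 9170) * h2011 +
        (-1074 * q - 3636) * h1111 +
        540 * h0211 +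
        (-537 * q ^ 2 - 3636 * q - 6144) * h0021 +
        (-133 * q ^ 4 - 1805 * q ^ 3 - 9170 * q ^ 2 - 20680 * q - 17472) * h0012
    exact (mul_eq_zero.1 h).resolve_left (by positivity)
  have hk : k ≤ 3 := by omega
  have hl : l ≤ 3 := by omega
  have hi : i ≤ 6 := by omega
  obtain rfl : j = 6 - i - 2 * k - 2 * l := by omega
  interval_cases k <;> interval_cases l <;> first | omega | skip
  all_goals interval_cases i <;> first | assumption | omega

/-- The linear functional on `P` with prescribed values on monomials. -/
def functional (T : ℕ → ℕ → ℕ → ℕ → ℚ) : P4 →ₗ[ℚ] ℚ :=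
  (basisMonomials (Fin 4) ℚ).constr ℚ fun m => T (m 0) (m 1) (m 2) (m 3)

theorem functional_mon (T : ℕ → ℕ → ℕ → ℕ → ℚ) (i j k l : ℕ) :
    functional T (mon i j k l) = T i j k l := by
  have h : mon i j k l = basisMonomials (Fin 4) ℚ (Finsupp.equivFunOnFinite.symm ![i, j, k, l]) := by
    simp [monomial_eq_C_mul_mon]
  rw [functional, h, Module.Basis.constr_basis]
  simp

theorem functional_eq_zero (g : ℤ) {T : ℕ → ℕ → ℕ → ℕ → ℚ} (hT : IsRec g T) {p : P4}
    (hp : Smk g p = 0) : functional T p = 0 := by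
  refine vanishing_of_isRec g _ ?_ (Ideal.Quotient.eq_zero_iff_mem.1 hp)
  simpa only [functional_mon] using hT

theorem a1_mul_a2'_pow_five : a1 * a2' ^ 5 = mon 1 5 0 0 := by simp [mon]

theorem a2'_pow_six : a2' ^ 6 = mon 0 6 0 0 := by simp [mon]

theorem c2_pow_three : c2 ^ 3 = mon 0 0 0 3 := by simp [mon]

theorem mon_mem_weightedHomogeneousSubmodule (i j k l : ℕ) :
    mon i j k l ∈ weightedHomogeneousSubmodule ℚ wt (i + j + 2 * k + 2 * l) := by
  rw [mem_weightedHomogeneousSubmodule]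
  have h (t : Fin 4) (n : ℕ) := (isWeightedHomogeneous_X ℚ wt t).pow n
  have hw : i + j + 2 * k + 2 * l = i • wt 0 + j • wt 1 + k • wt 2 + l • wt 3 := by
    simp [wt, mul_comm]
  rw [hw]
  exact (((h 0 i).mul (h 1 j)).mul (h 2 k)).mul (h 3 l)

theorem linearIndependent_weight_six (g : ℤ) :
    LinearIndependent ℚ ![Smk g (a1 * a2' ^ 5), Smk g (a2' ^ 6), Smk g (c2 ^ 3)] := by
  rw [Fintype.linearIndependent_iff]
  intro c hc
  simp only [Fin.sum_univ_three, Matrix.cons_val, ← map_smul, ← map_add] at hc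
  have h₀ := functional_eq_zero g (isRec_pi_single g one_lt_two 5) hc
  have h₁ := functional_eq_zero g (isRec_pi_single g zero_lt_two 6) hc
  have h₂ := functional_eq_zero g (isRec_c2CubeCoeff g) hc
  simp only [a1_mul_a2'_pow_five, a2'_pow_six, c2_pow_three, map_add, map_smul, functional_mon,
    c2CubeCoeff.eq_def] at h₀ h₁ h₂
  norm_num at h₀ h₁ h₂
  intro t
  fin_cases t <;> assumption

theorem SComp_six_eq_span (g : ℤ) (hg : 0 < g) :
    SComp g 6 = Submodule.span ℚ {Smk g (a1 * a2' ^ 5), Smk g (a2' ^ 6), Smk g (c2 ^ 3)} := by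
  apply le_antisymm
  · rintro _ ⟨p, hp, rfl⟩
    by_contra hmem
    obtain ⟨θ, hθ, hle⟩ := Submodule.exists_le_ker_of_notMem hmem
    have hT := isRec_of_vanishing g (θ ∘ₗ Smk g) fun p hp => by
      rw [LinearMap.comp_apply, show Smk g p = 0 from Ideal.Quotient.eq_zero_iff_mem.2 hp, map_zero]
    have hspan (x) (hx : x ∈ ({Smk g (a1 * a2' ^ 5), Smk g (a2' ^ 6), Smk g (c2 ^ 3)} : Set _)) :
        θ x = 0 := hle (Submodule.subset_span hx)
    have hzero {i j k l : ℕ} (h : i + j + 2 * k + 2 * l = 6) : θ (Smk g (mon i j k l)) = 0 :=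
      hT.eq_zero_of_weight_six (Int.cast_pos.2 hg)
        (hspan _ (by simp [a1_mul_a2'_pow_five])) (hspan _ (by simp [a2'_pow_six]))
        (hspan _ (by simp [c2_pow_three])) h
    apply hθ
    rw [p.as_sum, map_sum, map_sum]
    refine Finset.sum_eq_zero fun m hm => ?_
    have hw := hp (mem_support_iff.1 hm)
    rw [Finsupp.weight_apply, Finsupp.sum_fintype _ _ (by simp)] at hw
    rw [monomial_eq_C_mul_mon, ← smul_eq_C_mul, map_smul, map_smul, hzero, smul_zero]
    simpa [Fin.sum_univ_four, wt, mul_comm] using hw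
  · rw [Submodule.span_le]
    rintro _ (rfl | rfl | rfl)
    · exact ⟨_, a1_mul_a2'_pow_five ▸ mon_mem_weightedHomogeneousSubmodule 1 5 0 0, rfl⟩
    · exact ⟨_, a2'_pow_six ▸ mon_mem_weightedHomogeneousSubmodule 0 6 0 0, rfl⟩
    · exact ⟨_, c2_pow_three ▸ mon_mem_weightedHomogeneousSubmodule 0 0 0 3, rfl⟩

/-- For `g > 106`, the images of `a₁a₂′⁵, a₂′⁶, c₂³` form a `ℚ`-basis of `S(g)_6`;
in particular `dim_ℚ S(g)_6 = 3`. -/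
theorem basis_SComp_six (g : ℤ) (hg : g > 106) :
    LinearIndependent ℚ ![Smk g (a1 * a2'^5), Smk g (a2'^6), Smk g (c2^3)] ∧
    SComp g 6 = Submodule.span ℚ {Smk g (a1 * a2'^5), Smk g (a2'^6), Smk g (c2^3)} ∧
    Module.finrank ℚ (SComp g 6) = 3 := by
  have hli := linearIndependent_weight_six g
  have hspan := SComp_six_eq_span g (by omega)
  refine ⟨hli, hspan, ?_⟩
  have hcard := finrank_span_eq_card hli
  rwa [Matrix.range_cons, Matrix.range_cons, Matrix.range_cons, Matrix.range_empty,
    Set.union_empty, Set.singleton_union, Set.singleton_union, ← hspan, Fintype.card_fin] at hcard
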